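/- Suppose W = Z + Y where Z ~ Poisson(λ₀) with λ₀ > 0 is independent of the ℤ₊-valued Y, and W satisfies the hypotheses of the preceding negative-binomial Stein bound with mean λ, variance v > λ, and second factorial moments of the coupling variables bounded: ∫_Γ E[ξ_α] λ̄(dα) ≤ ελ and ∫_Γ E[ξ_α(ξ_α−1)] λ̄(dα) ≤ σλ for constants ε, σ ≥ 0. Then with r = λ²/(v−λ), q = λ/v, one has d_TV(W, NB(r,q)) ≤ (2ε² + σ)/√(2eλ₀). -/

import Mathlib

open MeasureTheory ProbabilityTheory

/-- Total variation distance between a distribution on ℤ₊ and a probability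
mass function p on ℤ₊. -/
noncomputable def dTVpmf (μ : Measure ℕ) (p : ℕ → ℝ) : ℝ :=
  ⨆ A : Set ℕ, |(μ A).toReal - ∑' i : ℕ, Set.indicator A p i|

/-- The negative binomial probability mass function NB(r,q). -/
noncomputable def nbPMF (r q : ℝ) (i : ℕ) : ℝ :=
  Real.Gamma (r + i) / (Real.Gamma r * (Nat.factorial i)) * q ^ r * (1 - q) ^ i

lemma nb_choose_eq (r : ℝ) (hr : 0 < r) (n : ℕ) :
    Ring.choose (r + n - 1) n = Real.Gamma (r + n) / (Real.Gamma r * (Nat.factorial n)) := by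
  have h1 : Ring.choose (r + n - 1) n = Ring.multichoose r n := by
    rw [Ring.choose]; congr 1; ring
  have h2 := Ring.factorial_nsmul_multichoose_eq_ascPochhammer r n
  have h3 : ∀ m : ℕ, (ascPochhammer ℕ m).smeval r = Real.Gamma (r + m) / Real.Gamma r := by
    have hG : Real.Gamma r ≠ 0 := (Real.Gamma_pos_of_pos hr).ne'
    intro m
    rw [Polynomial.ascPochhammer_smeval_eq_eval]
    induction m with
    | zero => simp [hG]
    | succ k ih =>
      rw [ascPochhammer_succ_eval, ih]
      have : r + ((k + 1 : ℕ) : ℝ) = (r + k) + 1 := by push_cast; ring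
      rw [this, Real.Gamma_add_one (by positivity)]
      ring
  rw [h1]
  rw [h3, nsmul_eq_mul] at h2
  have hf : (Nat.factorial n : ℝ) ≠ 0 := by positivity
  field_simp at h2 ⊢
  linarith

lemma nb_hasSum (r q : ℝ) (hr : 0 < r) (hq0 : 0 < q) (hq1 : q < 1) :
    HasSum (nbPMF r q) 1 := by
  have h := Real.one_div_one_sub_rpow_hasFPowerSeriesOnBall_zero r
  have h2 := h.hasSum (y := 1 - q) (by
    simp only [Metric.mem_eball, edist_zero_right]
    rw [← ofReal_norm, Real.norm_eq_abs, abs_of_pos (by linarith), ← ENNReal.ofReal_one]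
    exact (ENNReal.ofReal_lt_ofReal_iff one_pos).2 (by linarith))
  simp only [FormalMultilinearSeries.ofScalars_apply_eq, zero_add, sub_sub_cancel] at h2
  have h3 := h2.mul_right (q ^ r)
  rw [one_div, inv_mul_cancel₀ (Real.rpow_pos_of_pos hq0 r).ne'] at h3
  have e : nbPMF r q = fun i : ℕ => Ring.choose (r + i - 1) i • (1 - q) ^ i * q ^ r := by
    funext n
    rw [nbPMF, nb_choose_eq r hr, smul_eq_mul]
    ring
  rw [e]
  exact h3

lemma nb_pos (r q : ℝ) (hr : 0 < r) (hq0 : 0 < q) (hq1 : q < 1) (i : ℕ) : 0 < nbPMF r q i := by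
  have h1 : 0 < Real.Gamma (r + i) := Real.Gamma_pos_of_pos (by positivity)
  have h2 := Real.Gamma_pos_of_pos hr
  have h3 : 0 < 1 - q := by linarith
  have := Real.rpow_pos_of_pos hq0 r
  unfold nbPMF
  positivity

lemma nb_rec (r q : ℝ) (hr : 0 < r) (i : ℕ) :
    ((i : ℝ) + 1) * nbPMF r q (i + 1) = (1 - q) * (r + i) * nbPMF r q i := by
  have h2 := (Real.Gamma_pos_of_pos hr).ne'
  have : r + ((i + 1 : ℕ) : ℝ) = (r + i) + 1 := by push_cast; ring
  rw [nbPMF, nbPMF, this, Real.Gamma_add_one (by positivity), Nat.factorial_succ, pow_succ]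
  have hf : (Nat.factorial i : ℝ) ≠ 0 := by positivity
  push_cast
  field_simp

lemma nb_stein (π : ℕ → ℝ) (p r : ℝ) (hp0 : 0 < p) (hp1 : p < 1) (hr : 0 < r)
    (hpos : ∀ i, 0 < π i) (hsum : HasSum π 1)
    (hrec : ∀ i : ℕ, ((i : ℝ) + 1) * π (i + 1) = p * (r + i) * π i) (A : Set ℕ) :
    ∃ g : ℕ → ℝ, (∃ C, ∀ i, |g i| ≤ C) ∧ (∀ i, |g (i + 2) - g (i + 1)| ≤ 1 / (p * r)) ∧
      ∀ i : ℕ, p * (r + i) * g (i + 1) - i * g i =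
        A.indicator 1 i - ∑' j, A.indicator π j := by
  classical
  set PA := ∑' j, A.indicator π j with hPA
  have hnn : ∀ i, 0 ≤ A.indicator π i := fun i =>
    Set.indicator_nonneg (fun j _ => (hpos j).le) i
  have hle : ∀ i, A.indicator π i ≤ π i := fun i =>
    Set.indicator_le_self' (fun j _ => (hpos j).le) i
  have hsA : HasSum (A.indicator π) PA := (hsum.summable.indicator A).hasSum
  let F : ℕ → ℝ := fun n => ∑ j ∈ Finset.range n, π j
  let L : ℕ → ℝ := fun n => ∑ j ∈ Finset.range n, A.indicator π j
  have hFs : ∀ n, F (n + 1) = F n + π n := fun n => Finset.sum_range_succ _ _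
  have hLs : ∀ n, L (n + 1) = L n + A.indicator π n := fun n => Finset.sum_range_succ _ _
  have hT : ∀ n, HasSum (fun j => π (j + n)) (1 - F n) := fun n =>
    (hasSum_nat_add_iff' n).2 hsum
  have hR : ∀ n, HasSum (fun j => A.indicator π (j + n)) (PA - L n) := fun n =>
    (hasSum_nat_add_iff' n).2 hsA
  have hF0 : ∀ n, 0 ≤ F n := fun n => Finset.sum_nonneg fun j _ => (hpos j).le
  have hL0 : ∀ n, 0 ≤ L n := fun n => Finset.sum_nonneg fun j _ => hnn j
  have hLF : ∀ n, L n ≤ F n := fun n => Finset.sum_le_sum fun j _ => hle j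
  have hT0 : ∀ n, 0 ≤ 1 - F n := fun n => (hT n).nonneg fun j => (hpos _).le
  have hR0 : ∀ n, 0 ≤ PA - L n := fun n => (hR n).nonneg fun j => hnn _
  have hRT : ∀ n, PA - L n ≤ 1 - F n := fun n => hasSum_le (fun j => hle _) (hR n) (hT n)
  have mono1 : ∀ i : ℕ, p * (r + i) * F i ≤ i * F (i + 1) := by
    intro i
    induction i with
    | zero => simp [F]
    | succ k ih =>
      have h1 := hFs (k + 1)
      have h2 := hFs k
      have h3 := hrec k
      have h4 := hF0 (k + 1)
      push_cast
      rw [h1]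
      have : p * F (k + 1) ≤ F (k + 1) := by nlinarith
      have e : p * (r + (k + 1)) * F (k + 1) =
        p * (r + k) * F k + p * (r + k) * π k + p * F (k + 1) := by
          rw [h2]; ring
      rw [e]
      linarith
  have mono2 : ∀ i : ℕ, i * (1 - F (i + 1)) ≤ p * (r + i) * (1 - F i) := by
    intro i
    refine hasSum_le (fun j => ?_) ((hT (i + 1)).mul_left (i : ℝ)) ((hT i).mul_left (p * (r + i)))
    have h3 := hrec (j + i)
    have h4 := hpos (j + i)
    have h5 : π (j + (i + 1)) = p * (r + (j + i : ℕ)) * π (j + i) / ((j + i : ℕ) + 1) := by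
      rw [← h3, ← add_assoc]; field_simp
    rw [h5, mul_div_assoc', div_le_iff₀ (by positivity)]
    push_cast
    have : (i : ℝ) * (r + (j + i)) ≤ (r + i) * (j + i + 1) := by
      have : 0 ≤ (j : ℝ) * r := by positivity
      have : (0 : ℝ) ≤ i := by positivity
      nlinarith
    have h6 : 0 < p * π (j + i) := by positivity
    nlinarith [mul_le_mul_of_nonneg_left this h6.le]
  let S : ℕ → ℝ := fun n => L n - PA * F n
  have key : ∀ i : ℕ, |i * S (i + 1) - p * (r + i) * S i| ≤ i * π i := by
    intro i
    have m1 := mono1 i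
    have m2 := mono2 i
    have ha : 0 ≤ p * (r + i) := by positivity
    simp only [S]
    have e := hLs i
    have f := hFs i
    have M0 := hnn i
    have M1 := hle i
    have pp := hpos i
    have L0 := hL0 i
    have LF := hLF i
    have R0 := hR0 (i + 1)
    have RT := hRT (i + 1)
    have T1 := hT0 (i + 1)
    have F0 := hF0 i
    generalize p * (r + i) = a at *
    generalize A.indicator π i = M at *
    have hi : (0 : ℝ) ≤ i := by positivity
    generalize (i : ℝ) = x at *
    obtain ⟨R', hR'⟩ : ∃ R', R' = PA - L (i + 1) := ⟨_, rfl⟩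
    obtain ⟨T', hT'⟩ : ∃ T', T' = 1 - F (i + 1) := ⟨_, rfl⟩
    have hPA' : PA = R' + L i + M := by rw [hR', e]; ring
    have hF' : F i = 1 - T' - π i := by rw [hT', f]; ring
    have id : x * (L (i + 1) - PA * F (i + 1)) - a * (L i - PA * F i) =
        L i * (x * T' - a * (1 - F i)) + M * (x * T' + a * F i)
          + R' * (a * F i - x * F (i + 1)) := by
      rw [e, hPA', f, hF']; ring
    rw [← hR'] at R0 RT
    rw [← hT'] at RT T1 m2
    rw [id, abs_le]
    have c1 : 0 ≤ a * (1 - F i) - x * T' := by linarith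
    have c2 : 0 ≤ x * F (i + 1) - a * F i := by linarith
    have c3 : 0 ≤ x * T' + a * F i := by positivity
    have c4 : x * T' + a * F i ≤ x := by
      have : x * T' + x * F (i + 1) = x := by rw [hT']; ring
      linarith
    constructor
    · have b1 := mul_le_mul_of_nonneg_right LF c1
      have b2 := mul_le_mul_of_nonneg_right RT c2
      have b3 : 0 ≤ M * (x * T' + a * F i) := by positivity
      have b4 : F i * (a * (1 - F i) - x * T') + T' * (x * F (i + 1) - a * F i)
          = π i * (x * T' + a * F i) := by
        rw [f, hF']; ring
      have b5 := mul_le_mul_of_nonneg_left c4 pp.le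
      nlinarith
    · have b1 := mul_nonneg L0 c1
      have b2 := mul_nonneg R0 c2
      have b3 := mul_le_mul_of_nonneg_right M1 c3
      have b5 := mul_le_mul_of_nonneg_left c4 pp.le
      nlinarith
  have hS0 : S 0 = 0 := by simp [S, L, F]
  have hSabs : ∀ n, |S n| ≤ 1 - F n := by
    intro n
    have e : S n = L n * (1 - F n) - (PA - L n) * F n := by simp only [S]; ring
    have h1 := mul_nonneg (hL0 n) (hT0 n)
    have h2 := mul_nonneg (hR0 n) (hF0 n)
    have h3 := mul_le_mul_of_nonneg_right (hLF n) (hT0 n)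
    have h4 := mul_le_mul_of_nonneg_right (hRT n) (hF0 n)
    have h5 := hT0 n
    have h6 := hF0 n
    rw [e, abs_le]; constructor <;> nlinarith
  have hSs : ∀ i, S (i + 1) - S i = π i * (A.indicator 1 i - PA) := by
    intro i
    simp only [S, hLs, hFs]
    by_cases hi : i ∈ A <;> simp [hi] <;> ring
  refine ⟨fun i => S i / (i * π i), ⟨(1 - F 1) / π 1, ?_⟩, ?_, ?_⟩
  · have hb : ∀ i : ℕ, (1 - F (i + 1)) / (((i + 1 : ℕ) : ℝ) * π (i + 1)) ≤ (1 - F 1) / π 1 := by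
      intro i
      induction i with
      | zero => simp
      | succ k ih =>
        refine le_trans ?_ ih
        have h1 := mono2 (k + 1)
        have h2 := hrec (k + 1)
        have h3 := hpos (k + 1)
        have h4 := hpos (k + 1 + 1)
        have e : ((k + 1 + 1 : ℕ) : ℝ) * π (k + 1 + 1) = p * (r + (k + 1 : ℕ)) * π (k + 1) := by
          rw [← h2]; push_cast; ring
        rw [e, div_le_div_iff₀ (by positivity) (by positivity)]
        nlinarith
    intro i
    cases i with
    | zero => simpa using div_nonneg (hT0 1) (hpos 1).le
    | succ k =>
      refine le_trans ?_ (hb k)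
      have h3 := hpos (k + 1)
      rw [abs_div, abs_of_pos (a := ((k + 1 : ℕ) : ℝ) * π (k + 1)) (by positivity)]
      gcongr
      exact hSabs _
  · intro i
    have h1 := key (i + 1)
    have h2 := hrec (i + 1)
    have h3 := hpos (i + 1)
    have e : ((i + 2 : ℕ) : ℝ) * π (i + 2) = p * (r + (i + 1 : ℕ)) * π (i + 1) := by
      rw [← h2]; push_cast; ring
    simp only [e]
    have hx : (0 : ℝ) < (i + 1 : ℕ) := by positivity
    generalize ((i + 1 : ℕ) : ℝ) = x at *
    have e2 : S (i + 2) / (p * (r + x) * π (i + 1)) - S (i + 1) / (x * π (i + 1)) =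
      (x * S (i + 1 + 1) - p * (r + x) * S (i + 1)) / (p * (r + x) * x * π (i + 1)) := by
      field_simp
    rw [e2, abs_div, abs_of_pos (a := p * (r + x) * x * π (i + 1)) (by positivity)]
    calc _ ≤ (x * π (i + 1)) / (p * (r + x) * x * π (i + 1)) := by gcongr
      _ = 1 / (p * (r + x)) := by field_simp
      _ ≤ _ := by
        apply one_div_le_one_div_of_le (by positivity)
        nlinarith
  · intro i
    have h3 := hpos i
    have h4 := hpos (i + 1)
    have h1 : p * (r + i) * (S (i + 1) / (((i + 1 : ℕ) : ℝ) * π (i + 1))) = S (i + 1) / π i := by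
      have : ((i + 1 : ℕ) : ℝ) * π (i + 1) = p * (r + i) * π i := by
        rw [← hrec]; push_cast; ring
      rw [this]
      have : 0 < r + i := by positivity
      field_simp
    have h2 : (i : ℝ) * (S i / (i * π i)) = S i / π i := by
      rcases Nat.eq_zero_or_pos i with rfl | hi
      · simp [hS0]
      · have : (0 : ℝ) < i := by exact_mod_cast hi
        field_simp
    rw [h1, h2, ← sub_div, hSs]
    field_simp

lemma po_log_aux (s : ℝ) (h0 : 0 ≤ s) (h1 : s < 1) :
    (1 + s) * Real.log (1 + s) - (1 - s) * Real.log (1 - s) ≤ 2 * s := by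
  let f : ℝ → ℝ := fun s => (1 + s) * Real.log (1 + s) - (1 - s) * Real.log (1 - s) - 2 * s
  have hd : ∀ x ∈ Set.Ico (0 : ℝ) 1, HasDerivAt f (Real.log (1 + x) + Real.log (1 - x)) x := by
    intro x hx
    have ha : HasDerivAt (fun s : ℝ => 1 + s) 1 x := by simpa using (hasDerivAt_id x).const_add 1
    have hb : HasDerivAt (fun s : ℝ => 1 - s) (-1) x := by
      simpa using (hasDerivAt_id x).const_sub 1
    have n1 : 1 + x ≠ 0 := by linarith [hx.1]
    have n2 : 1 - x ≠ 0 := by linarith [hx.2]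
    have := ((ha.mul (ha.log n1)).sub (hb.mul (hb.log n2))).sub ((hasDerivAt_id x).const_mul 2)
    have i1 : (1 + x) * (1 / (1 + x)) = 1 := by field_simp
    have i2 : (1 - x) * (-1 / (1 - x)) = -1 := by field_simp
    refine HasDerivAt.congr_deriv this ?_
    rw [i1, i2]
    ring
  have hanti : AntitoneOn f (Set.Ico 0 1) := by
    apply antitoneOn_of_deriv_nonpos (convex_Ico 0 1)
    · exact fun x hx => (hd x hx).continuousAt.continuousWithinAt
    · intro x hx
      exact (hd x (interior_subset hx)).differentiableAt.differentiableWithinAt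
    · intro x hx
      have hx' := interior_subset hx
      rw [(hd x hx').deriv, ← Real.log_mul (by linarith [hx'.1]) (by linarith [hx'.2])]
      apply Real.log_nonpos
      · nlinarith [hx'.1, hx'.2]
      · nlinarith [hx'.1, hx'.2]
  have := hanti (a := 0) (b := s) ⟨le_rfl, one_pos⟩ ⟨h0, h1⟩ h0
  simp only [f] at this
  simp at this
  linarith

lemma po_fact (k : ℕ) :
    (k + 1 / 2 : ℝ) * Real.log (k + 1 / 2) - (k + 1 / 2) - Real.log (Nat.factorial k)
      ≤ -(1 / 2) * (Real.log 2 + 1) := by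
  induction k with
  | zero =>
    have : Real.log (1 / 2) = - Real.log 2 := by simp
    simp only [Nat.cast_zero, zero_add, Nat.factorial_zero, Nat.cast_one, Real.log_one, this]
    linarith
  | succ k ih =>
    refine le_trans ?_ ih
    have hx : (0 : ℝ) < k + 1 := by positivity
    have hs : 1 / (2 * ((k : ℝ) + 1)) < 1 := by
      rw [div_lt_one (by positivity)]
      have : (0 : ℝ) ≤ k := by positivity
      linarith
    have h := po_log_aux (1 / (2 * (k + 1))) (by positivity) hs
    have e1 : (1 + 1 / (2 * ((k : ℝ) + 1))) = (k + 1 + 1 / 2) / (k + 1) := by field_simp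
    have e2 : (1 - 1 / (2 * ((k : ℝ) + 1))) = (k + 1 / 2) / (k + 1) := by field_simp; ring
    rw [e1, e2, Real.log_div (by positivity) hx.ne', Real.log_div (by positivity) hx.ne'] at h
    rw [Nat.factorial_succ]
    push_cast
    rw [Real.log_mul hx.ne' (by positivity)]
    have h' := mul_le_mul_of_nonneg_left h hx.le
    have e3 : ((k : ℝ) + 1) * ((k + 1 + 1 / 2) / (k + 1) * (Real.log (k + 1 + 1 / 2) - Real.log (k + 1))
        - (k + 1 / 2) / (k + 1) * (Real.log (k + 1 / 2) - Real.log (k + 1))) =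
      (k + 1 + 1 / 2) * Real.log (k + 1 + 1 / 2) - (k + 1 / 2) * Real.log (k + 1 / 2)
        - Real.log (k + 1) := by field_simp; ring
    have e4 : ((k : ℝ) + 1) * (2 * (1 / (2 * (k + 1)))) = 1 := by field_simp
    rw [e3, e4] at h'
    linarith

lemma po_le (l : ℝ) (hl : 0 < l) (k : ℕ) :
    Real.exp (-l) * l ^ k / (Nat.factorial k) ≤ 1 / Real.sqrt (2 * Real.exp 1 * l) := by
  have hpos : 0 < Real.exp (-l) * l ^ k / (Nat.factorial k) := by positivity
  rw [← Real.log_le_log_iff hpos (by positivity)]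
  rw [Real.log_div (by positivity) (by positivity), Real.log_mul (by positivity) (by positivity),
    Real.log_exp, Real.log_pow, one_div, Real.log_inv, Real.log_sqrt (by positivity),
    Real.log_mul (by positivity) (by positivity), Real.log_mul (by positivity) (by positivity),
    Real.log_exp]
  have h := po_fact k
  have hx : (0 : ℝ) < k + 1 / 2 := by positivity
  have h2 := Real.log_le_sub_one_of_pos (div_pos hl hx)
  rw [Real.log_div hl.ne' hx.ne'] at h2
  have h3 := mul_le_mul_of_nonneg_left h2 hx.le
  have e : ((k : ℝ) + 1 / 2) * (l / (k + 1 / 2) - 1) = l - (k + 1 / 2) := by field_simp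
  rw [e] at h3
  nlinarith

lemma po_tv (w : ℕ → ℝ) (l d : ℝ) (hl : 0 < l)
    (hw : ∀ k, w k = Real.exp (-l) * l ^ k / (Nat.factorial k)) (hd : ∀ k, w k ≤ d)
    (u : ℕ → ℝ) (M : ℝ) (hu : ∀ i, |u i| ≤ M) (hs : Summable w) :
    |∑' k, w k * u (k + 1) - ∑' k, w k * u k| ≤ M * (2 * d) := by
  have hw0 : ∀ k, 0 ≤ w k := fun k => by rw [hw]; positivity
  have hM : 0 ≤ M := (abs_nonneg _).trans (hu 0)
  have hrec : ∀ k : ℕ, w (k + 1) * (k + 1) = l * w k := by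
    intro k
    rw [hw, hw, Nat.factorial_succ]
    push_cast
    field_simp
    ring
  have hs1 : Summable (fun k => w k * u k) := by
    refine Summable.of_norm_bounded (hs.mul_right M) fun k => ?_
    rw [norm_mul, Real.norm_of_nonneg (hw0 k)]
    exact mul_le_mul_of_nonneg_left (hu k) (hw0 k)
  have hs2 : Summable (fun k => w k * u (k + 1)) := by
    refine Summable.of_norm_bounded (hs.mul_right M) fun k => ?_
    rw [norm_mul, Real.norm_of_nonneg (hw0 k)]
    exact mul_le_mul_of_nonneg_left (hu _) (hw0 k)
  have hs1' := (summable_nat_add_iff 1).2 hs1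
  have hs' := (summable_nat_add_iff 1).2 hs
  rw [hs1.tsum_eq_zero_add]
  have e : ∑' k, w k * u (k + 1) - (w 0 * u 0 + ∑' k, w (k + 1) * u (k + 1)) =
      ∑' k, (w k - w (k + 1)) * u (k + 1) - w 0 * u 0 := by
    have : ∀ k, (w k - w (k + 1)) * u (k + 1) = w k * u (k + 1) - w (k + 1) * u (k + 1) :=
      fun k => by ring
    simp only [this]
    rw [hs2.tsum_sub hs1']
    ring
  rw [e]
  have hsabs : Summable (fun k => |w k - w (k + 1)|) := (hs.sub hs').abs
  -- total variation
  have htv : ∑' k, |w k - w (k + 1)| ≤ 2 * d - w 0 := by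
    refine hsabs.tsum_le_of_sum_range_le fun n => ?_
    have hA : ∀ n : ℕ, (n : ℝ) ≤ l → ∑ k ∈ Finset.range n, |w k - w (k + 1)| = w n - w 0 := by
      intro n
      induction n with
      | zero => simp
      | succ n ih =>
        intro hn
        push_cast at hn
        rw [Finset.sum_range_succ, ih (by linarith)]
        have h1 := hrec n
        have h2 := hw0 (n + 1)
        have h3 := hw0 n
        have : w n ≤ w (n + 1) := by
          by_contra hc
          push Not at hc
          nlinarith
        rw [abs_of_nonpos (by linarith)]
        ring
    have hB : ∀ n : ℕ, ∑ k ∈ Finset.range n, |w k - w (k + 1)| ≤ 2 * d - w 0 ∧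
        (l < n → ∑ k ∈ Finset.range n, |w k - w (k + 1)| ≤ 2 * d - w n - w 0) := by
      intro n
      induction n with
      | zero =>
        refine ⟨?_, fun h => ?_⟩
        · have := hd 0
          have := hw0 0
          simp; linarith
        · simp at h; linarith
      | succ n ih =>
        have hd1 := hd (n + 1)
        have hd0 := hd n
        have h2 := hw0 (n + 1)
        have h3 := hw0 n
        have h1 := hrec n
        by_cases hn : ((n + 1 : ℕ) : ℝ) ≤ l
        · rw [hA _ hn]
          refine ⟨by linarith, fun h => absurd hn (not_le.2 h)⟩
        · push Not at hn
          have hdec : w (n + 1) ≤ w n := by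
            push_cast at hn
            by_contra hc
            push Not at hc
            nlinarith
          have : ∑ k ∈ Finset.range (n + 1), |w k - w (k + 1)| ≤ 2 * d - w (n + 1) - w 0 := by
            rw [Finset.sum_range_succ, abs_of_nonneg (by linarith)]
            by_cases hn' : (n : ℝ) ≤ l
            · rw [hA n hn']; linarith
            · have := ih.2 (not_le.1 hn')
              linarith
          exact ⟨by linarith, fun _ => this⟩
    exact (hB n).1
  have hb1 : |∑' k, (w k - w (k + 1)) * u (k + 1)| ≤ (∑' k, |w k - w (k + 1)|) * M := by
    rw [← tsum_mul_right, ← Real.norm_eq_abs]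
    refine tsum_of_norm_bounded (hsabs.mul_right M).hasSum fun k => ?_
    rw [norm_mul]
    exact mul_le_mul_of_nonneg_left (hu _) (abs_nonneg _)
  have hb2 : |w 0 * u 0| ≤ w 0 * M := by
    rw [abs_mul, abs_of_nonneg (hw0 0)]
    exact mul_le_mul_of_nonneg_left (hu _) (hw0 0)
  refine (abs_sub _ _).trans ?_
  have := mul_le_mul_of_nonneg_right htv hM
  linarith

section prob
variable {Ω : Type*} [MeasurableSpace Ω] (P : Measure Ω) [IsProbabilityMeasure P]

lemma integrable_bdd (V : Ω → ℕ) (hV : Measurable V) (f : ℕ → ℝ) (C : ℝ)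
    (hf : ∀ i, |f i| ≤ C) : Integrable (fun ω => f (V ω)) P :=
  Integrable.of_bound ((measurable_from_nat (f := f)).comp hV).aestronglyMeasurable C
    (Filter.Eventually.of_forall fun _ => hf _)

lemma abs_integral_bdd (f : Ω → ℝ) (C : ℝ) (hf : ∀ i, |f i| ≤ C) : |∫ ω, f ω ∂P| ≤ C := by
  have := norm_integral_le_of_norm_le_const (μ := P) (f := f) (C := C)
    (Filter.Eventually.of_forall hf)
  simpa using this

lemma indep_integral (X V : Ω → ℕ) (hX : Measurable X) (hV : Measurable V)
    (hi : IndepFun X V P) (F : ℕ → ℕ → ℝ) (C : ℝ) (hF : ∀ i j, |F i j| ≤ C) :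
    ∫ ω, F (X ω) (V ω) ∂P = ∫ ω, (∫ ω', F (X ω) (V ω') ∂P) ∂P := by
  have h := (indepFun_iff_map_prod_eq_prod_map_map hX.aemeasurable hV.aemeasurable).1 hi
  have hm : Measurable (fun x : ℕ × ℕ => F x.1 x.2) := measurable_of_countable _
  have : IsProbabilityMeasure (P.map X) := Measure.isProbabilityMeasure_map hX.aemeasurable
  have : IsProbabilityMeasure (P.map V) := Measure.isProbabilityMeasure_map hV.aemeasurable
  have h1 : ∫ ω, F (X ω) (V ω) ∂P = ∫ x, F x.1 x.2 ∂(P.map (fun ω => (X ω, V ω))) := by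
    rw [integral_map (hX.prodMk hV).aemeasurable hm.aestronglyMeasurable]
  rw [h1, h, integral_prod]
  · rw [integral_map hX.aemeasurable (measurable_of_countable _).aestronglyMeasurable]
    refine integral_congr_ae (Filter.Eventually.of_forall fun ω => ?_)
    simp only
    rw [integral_map hV.aemeasurable (measurable_of_countable _).aestronglyMeasurable]
  · exact Integrable.of_bound hm.aestronglyMeasurable C (Filter.Eventually.of_forall fun x => hF _ _)

lemma integral_nat (V : Ω → ℕ) (hV : Measurable V) (f : ℕ → ℝ) (C : ℝ) (hf : ∀ i, |f i| ≤ C) :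
    ∫ ω, f (V ω) ∂P = ∑' k, (P (V ⁻¹' {k})).toReal * f k := by
  have : IsProbabilityMeasure (P.map V) := Measure.isProbabilityMeasure_map hV.aemeasurable
  have hm : Measurable f := measurable_from_nat
  rw [← integral_map hV.aemeasurable hm.aestronglyMeasurable, integral_countable]
  · refine tsum_congr fun k => ?_
    rw [smul_eq_mul, measureReal_def, Measure.map_apply hV (measurableSet_singleton k)]
  · exact Integrable.of_bound hm.aestronglyMeasurable C (Filter.Eventually.of_forall hf)

lemma summable_law (V : Ω → ℕ) (hV : Measurable V) :
    Summable (fun k => (P (V ⁻¹' {k})).toReal) := by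
  apply ENNReal.summable_toReal
  have : ∑' k, P (V ⁻¹' {k}) = ∑' k, (P.map V) {k} := by
    refine tsum_congr fun k => ?_
    rw [Measure.map_apply hV (measurableSet_singleton k)]
  have h2 := lintegral_countable' (μ := P.map V) (fun _ => 1)
  rw [this]
  simp only [one_mul] at h2
  rw [← h2]
  have : IsProbabilityMeasure (P.map V) := Measure.isProbabilityMeasure_map hV.aemeasurable
  simp

lemma W_tv (lam0 : ℝ) (hlam0 : 0 < lam0) (Z Y : Ω → ℕ)
    (hZ : Measurable Z) (hY : Measurable Y)
    (hZpois : ∀ k : ℕ, (P (Z ⁻¹' {k})).toReal =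
      Real.exp (-lam0) * lam0 ^ k / (Nat.factorial k))
    (hZYindep : IndepFun Z Y P) (u : ℕ → ℝ) (M : ℝ) (hu : ∀ i, |u i| ≤ M) :
    |∫ ω, u (Z ω + Y ω + 1) ∂P - ∫ ω, u (Z ω + Y ω) ∂P| ≤
      M * (2 * (1 / Real.sqrt (2 * Real.exp 1 * lam0))) := by
  rw [indep_integral P Y Z hY hZ hZYindep.symm (fun y z => u (z + y + 1)) M (fun _ _ => hu _),
    indep_integral P Y Z hY hZ hZYindep.symm (fun y z => u (z + y)) M (fun _ _ => hu _)]
  rw [← integral_sub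
    (integrable_bdd P Y hY (fun y => ∫ ω', u (Z ω' + y + 1) ∂P) M
      (fun y => abs_integral_bdd P _ M (fun _ => hu _)))
    (integrable_bdd P Y hY (fun y => ∫ ω', u (Z ω' + y) ∂P) M
      (fun y => abs_integral_bdd P _ M (fun _ => hu _)))]
  refine abs_integral_bdd P _ _ fun ω => ?_
  rw [integral_nat P Z hZ (fun z => u (z + Y ω + 1)) M (fun _ => hu _),
    integral_nat P Z hZ (fun z => u (z + Y ω)) M (fun _ => hu _)]
  have := po_tv (fun k => (P (Z ⁻¹' {k})).toReal) lam0 (1 / Real.sqrt (2 * Real.exp 1 * lam0)) hlam0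
    hZpois (fun k => by simp only [hZpois]; exact po_le lam0 hlam0 k) (fun z => u (z + Y ω)) M
    (fun _ => hu _) (summable_law P Z hZ)
  simpa only [add_right_comm] using this

lemma det_bound (G : ℕ → ℝ) (B p q : ℝ) (hp : 0 ≤ p) (hq : 0 ≤ q) (hpq : p + q = 1)
    (hB : ∀ j, |(G (j + 2) - G (j + 1)) - (G (j + 1) - G j)| ≤ B) (n : ℕ) :
    |q * G 0 + p * G (n + 1) - G n - (G 1 - G 0) * (p - q * n)| ≤
      B * (q * (n * (n - 1)) / 2 + p * n) := by
  have h1 : ∀ n : ℕ, |(G (n + 1) - G n) - (G 1 - G 0)| ≤ B * n := by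
    intro n
    induction n with
    | zero => simp
    | succ k ih =>
      have := hB k
      rw [abs_le] at *
      push_cast
      constructor <;> nlinarith
  have h2 : ∀ n : ℕ, |G n - G 0 - n * (G 1 - G 0)| ≤ B * (n * (n - 1) / 2) := by
    intro n
    induction n with
    | zero => simp
    | succ k ih =>
      have := h1 k
      rw [abs_le] at *
      push_cast
      constructor <;> nlinarith
  have e : q * G 0 + p * G (n + 1) - G n - (G 1 - G 0) * (p - q * n) =
      p * ((G (n + 1) - G n) - (G 1 - G 0)) - q * (G n - G 0 - n * (G 1 - G 0)) := by
    have : p = 1 - q := by linarith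
    subst this; ring
  rw [e]
  refine (abs_sub _ _).trans ?_
  rw [abs_mul, abs_mul, abs_of_nonneg hp, abs_of_nonneg hq]
  have a1 := mul_le_mul_of_nonneg_left (h1 n) hp
  have a2 := mul_le_mul_of_nonneg_left (h2 n) hq
  linarith

variable {Γ : Type*} [MeasurableSpace Γ] (lamBar : Measure Γ) [IsFiniteMeasure lamBar]

lemma W_pos (lam0 : ℝ) (hlam0 : 0 < lam0) (Z Y : Ω → ℕ)
    (hZpois : ∀ k : ℕ, (P (Z ⁻¹' {k})).toReal =
      Real.exp (-lam0) * lam0 ^ k / (Nat.factorial k))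
    (hY : Measurable Y) (hZ : Measurable Z)
    (hZYindep : IndepFun Z Y P) (ξ : Γ → Ω → ℕ)
    (hcoupling : ∀ f : ℕ → ℝ, (∃ C : ℝ, ∀ i, |f i| ≤ C) →
      ∫ ω, ((Z ω + Y ω : ℕ) : ℝ) * f (Z ω + Y ω) ∂P =
        ∫ α, (∫ ω, f (Z ω + Y ω + 1 + ξ α ω) ∂P) ∂lamBar) (k : ℕ) :
    P ((fun ω => Z ω + Y ω) ⁻¹' {k}) ≠ 0 := by
  classical
  have hprod : ∀ i j, P (Y ⁻¹' {j}) ≠ 0 → P ((fun ω => Z ω + Y ω) ⁻¹' {i + j}) ≠ 0 := by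
    intro i j hj h0
    have h1 := hZYindep.measure_inter_preimage_eq_mul {i} {j} (measurableSet_singleton _)
      (measurableSet_singleton _)
    have h2 : P (Z ⁻¹' {i} ∩ Y ⁻¹' {j}) = 0 := by
      refine measure_mono_null ?_ h0
      rintro ω ⟨h, h'⟩
      simp only [Set.mem_preimage, Set.mem_singleton_iff] at h h' ⊢
      rw [h, h']
    rw [h2] at h1
    have h3 : P (Z ⁻¹' {i}) ≠ 0 := by
      intro h
      have := hZpois i
      rw [h] at this
      have h4 : 0 < Real.exp (-lam0) * lam0 ^ i / (Nat.factorial i) := by positivity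
      rw [← this] at h4
      exact lt_irrefl _ h4
    exact (mul_ne_zero h3 hj) h1.symm
  have hex : ∃ j, P (Y ⁻¹' {j}) ≠ 0 := by
    by_contra hc
    push Not at hc
    have : P (⋃ j, Y ⁻¹' {j}) = 0 := measure_iUnion_null hc
    have h2 : (⋃ j, Y ⁻¹' {j}) = Set.univ := by ext ω; simp
    rw [h2] at this
    simp at this
  have hm := Nat.find_spec hex
  have hmin : ∀ j < Nat.find hex, P (Y ⁻¹' {j}) = 0 := fun j hj => by
    simpa using Nat.find_min hex hj
  generalize Nat.find hex = m at hm hmin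
  have hge : ∀ᵐ ω ∂P, m ≤ Y ω := by
    rw [ae_iff]
    have : {ω | ¬ m ≤ Y ω} = ⋃ j ∈ Finset.range m, Y ⁻¹' {j} := by
      ext ω; simp
    rw [this]
    refine (measure_biUnion_null_iff (Finset.range m).countable_toSet).2 ?_
    intro j hj
    exact hmin j (by simpa using hj)
  have hm0 : m = 0 := by
    by_contra hne
    have hc := hcoupling (Set.indicator {m} 1) ⟨1, fun i => by
      by_cases h : i = m <;> simp [h]⟩
    have hr : ∀ α, ∫ ω, (Set.indicator {m} 1 : ℕ → ℝ) (Z ω + Y ω + 1 + ξ α ω) ∂P = 0 := by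
      intro α
      apply integral_eq_zero_of_ae
      filter_upwards [hge] with ω hω
      have : Z ω + Y ω + 1 + ξ α ω ≠ m := by omega
      simp [this]
    simp only [hr, integral_zero] at hc
    have hl : ∀ ω, ((Z ω + Y ω : ℕ) : ℝ) * (Set.indicator {m} 1 : ℕ → ℝ) (Z ω + Y ω) =
        ((fun ω => Z ω + Y ω) ⁻¹' {m}).indicator (fun _ => (m : ℝ)) ω := by
      intro ω
      by_cases h : Z ω + Y ω = m <;> simp [h]
    simp only [hl] at hc
    have hms : MeasurableSet ((fun ω => Z ω + Y ω) ⁻¹' {m}) :=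
      (hZ.add hY) (measurableSet_singleton m)
    rw [integral_indicator hms] at hc
    simp [measureReal_def, ENNReal.toReal_eq_zero_iff] at hc
    have := hprod 0 m hm
    rw [zero_add] at this
    rcases hc with hc | hc
    · exact this hc
    · exact hne hc
  subst hm0
  simpa using hprod k 0 hm

lemma coupling_law (W : Ω → ℕ) (hW : Measurable W)
    (hpos : ∀ k, P (W ⁻¹' {k}) ≠ 0)
    (ξ : Γ → Ω → ℕ) (hξmeas : ∀ α, Measurable (ξ α))
    (hcoupling : ∀ f : ℕ → ℝ, (∃ C : ℝ, ∀ i, |f i| ≤ C) →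
      ∫ ω, (W ω : ℝ) * f (W ω) ∂P = ∫ α, (∫ ω, f (W ω + 1 + ξ α ω) ∂P) ∂lamBar) (k : ℕ) :
    AEMeasurable (fun α => P ((fun ω => W ω + 1 + ξ α ω) ⁻¹' {k})) lamBar ∧
      ∫⁻ α, P ((fun ω => W ω + 1 + ξ α ω) ⁻¹' {k}) ∂lamBar = k * P (W ⁻¹' {k}) := by
  classical
  rcases Nat.eq_zero_or_pos k with rfl | hk
  · have : ∀ α, (fun ω => W ω + 1 + ξ α ω) ⁻¹' {0} = ∅ := by
      intro α; ext ω; simp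
    simp [this]
  have hc := hcoupling (Set.indicator {k} 1) ⟨1, fun i => by
      by_cases h : i = k <;> simp [h]⟩
  have hl : ∀ ω, (W ω : ℝ) * (Set.indicator {k} 1 : ℕ → ℝ) (W ω) =
      (W ⁻¹' {k}).indicator (fun _ => (k : ℝ)) ω := by
    intro ω
    by_cases h : W ω = k <;> simp [h]
  have hr : ∀ α, ∫ ω, (Set.indicator {k} 1 : ℕ → ℝ) (W ω + 1 + ξ α ω) ∂P =
      (P ((fun ω => W ω + 1 + ξ α ω) ⁻¹' {k})).toReal := by
    intro α
    have hms : MeasurableSet ((fun ω => W ω + 1 + ξ α ω) ⁻¹' {k}) :=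
      ((hW.add_const 1).add (hξmeas α)) (measurableSet_singleton k)
    rw [← measureReal_def, ← integral_indicator_one hms]
    rfl
  simp only [hl, hr] at hc
  rw [integral_indicator (hW (measurableSet_singleton k))] at hc
  simp only [integral_const, smul_eq_mul, measureReal_def, Measure.restrict_apply_univ] at hc
  have hne : (P (W ⁻¹' {k})).toReal * (k : ℝ) ≠ 0 := by
    have : (k : ℝ) ≠ 0 := by exact_mod_cast hk.ne'
    refine mul_ne_zero ?_ this
    rw [ENNReal.toReal_ne_zero]
    exact ⟨hpos k, measure_ne_top _ _⟩
  have hint : Integrable (fun α => (P ((fun ω => W ω + 1 + ξ α ω) ⁻¹' {k})).toReal) lamBar := by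
    by_contra hcon
    rw [integral_undef hcon] at hc
    exact hne hc
  have heq : (fun α => P ((fun ω => W ω + 1 + ξ α ω) ⁻¹' {k})) =
      fun α => ENNReal.ofReal (P ((fun ω => W ω + 1 + ξ α ω) ⁻¹' {k})).toReal := by
    funext α
    rw [ENNReal.ofReal_toReal (measure_ne_top _ _)]
  constructor
  · rw [heq]
    exact hint.aestronglyMeasurable.aemeasurable.ennreal_ofReal
  · rw [heq, ← ofReal_integral_eq_lintegral_ofReal hint
      (Filter.Eventually.of_forall fun _ => ENNReal.toReal_nonneg), ← hc,
      ENNReal.ofReal_mul ENNReal.toReal_nonneg, ENNReal.ofReal_toReal (measure_ne_top _ _),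
      ENNReal.ofReal_natCast, mul_comm]

lemma lintegral_nat (V : Ω → ℕ) (hV : Measurable V) (f : ℕ → ENNReal) :
    ∫⁻ ω, f (V ω) ∂P = ∑' k, f k * P (V ⁻¹' {k}) := by
  have hm : Measurable f := measurable_from_nat
  rw [← lintegral_map hm hV, lintegral_countable']
  refine tsum_congr fun k => ?_
  rw [Measure.map_apply hV (measurableSet_singleton k)]

lemma coupling_lintegral (W : Ω → ℕ) (hW : Measurable W)
    (hpos : ∀ k, P (W ⁻¹' {k}) ≠ 0)
    (ξ : Γ → Ω → ℕ) (hξmeas : ∀ α, Measurable (ξ α))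
    (hcoupling : ∀ f : ℕ → ℝ, (∃ C : ℝ, ∀ i, |f i| ≤ C) →
      ∫ ω, (W ω : ℝ) * f (W ω) ∂P = ∫ α, (∫ ω, f (W ω + 1 + ξ α ω) ∂P) ∂lamBar)
    (f : ℕ → ENNReal) :
    AEMeasurable (fun α => ∫⁻ ω, f (W ω + 1 + ξ α ω) ∂P) lamBar ∧
      ∫⁻ α, (∫⁻ ω, f (W ω + 1 + ξ α ω) ∂P) ∂lamBar = ∫⁻ ω, (W ω : ENNReal) * f (W ω) ∂P := by
  have h := coupling_law P lamBar W hW hpos ξ hξmeas hcoupling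
  have e : ∀ α, ∫⁻ ω, f (W ω + 1 + ξ α ω) ∂P =
      ∑' k, f k * P ((fun ω => W ω + 1 + ξ α ω) ⁻¹' {k}) := fun α =>
    lintegral_nat P _ ((hW.add_const 1).add (hξmeas α)) f
  simp only [e]
  have hm : ∀ k, AEMeasurable (fun α => f k * P ((fun ω => W ω + 1 + ξ α ω) ⁻¹' {k})) lamBar :=
    fun k => (h k).1.const_mul _
  refine ⟨AEMeasurable.ennreal_tsum hm, ?_⟩
  rw [lintegral_tsum hm, lintegral_nat P W hW (fun n => (n : ENNReal) * f n)]
  refine tsum_congr fun k => ?_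
  rw [lintegral_const_mul'' _ (h k).1, (h k).2]
  ring

lemma coupling_integrable (W : Ω → ℕ) (hW : Measurable W)
    (hpos : ∀ k, P (W ⁻¹' {k}) ≠ 0)
    (ξ : Γ → Ω → ℕ) (hξmeas : ∀ α, Measurable (ξ α))
    (hcoupling : ∀ f : ℕ → ℝ, (∃ C : ℝ, ∀ i, |f i| ≤ C) →
      ∫ ω, (W ω : ℝ) * f (W ω) ∂P = ∫ α, (∫ ω, f (W ω + 1 + ξ α ω) ∂P) ∂lamBar)
    (f : ℕ → ℝ) (C : ℝ) (hf : ∀ i, |f i| ≤ C) :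
    Integrable (fun α => ∫ ω, f (W ω + 1 + ξ α ω) ∂P) lamBar := by
  refine Integrable.of_bound (C := C) ?_
    (Filter.Eventually.of_forall fun α => abs_integral_bdd P _ C fun _ => hf _)
  have h := (coupling_lintegral P lamBar W hW hpos ξ hξmeas hcoupling
    (fun i => ENNReal.ofReal (f i + C))).1
  have e : (fun α => ∫ ω, f (W ω + 1 + ξ α ω) ∂P) = fun α =>
      (∫⁻ ω, ENNReal.ofReal (f (W ω + 1 + ξ α ω) + C) ∂P).toReal - C := by
    funext α
    have hV : Measurable (fun ω => W ω + 1 + ξ α ω) := (hW.add_const 1).add (hξmeas α)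
    have hi := integrable_bdd P _ hV f C hf
    rw [← integral_eq_lintegral_of_nonneg_ae, integral_add hi (integrable_const C)]
    · simp
    · exact Filter.Eventually.of_forall fun ω => by
        have := neg_le_of_abs_le (hf (W ω + 1 + ξ α ω))
        simp only [Pi.zero_apply]
        linarith
    · exact (hi.add (integrable_const C)).aestronglyMeasurable
  rw [e]
  exact (h.ennreal_toReal.sub_const C).aestronglyMeasurable

end prob

lemma nat_lintegral {Ω : Type*} [MeasurableSpace Ω] (P : Measure Ω) (V : Ω → ℕ)
    (hi : Integrable (fun ω => (V ω : ℝ)) P) :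
    ∫⁻ ω, (V ω : ENNReal) ∂P = ENNReal.ofReal (∫ ω, (V ω : ℝ) ∂P) := by
  rw [ofReal_integral_eq_lintegral_ofReal hi (Filter.Eventually.of_forall fun _ => by simp)]
  simp

lemma nat_integrable_of_lintegral {Ω : Type*} [MeasurableSpace Ω] (P : Measure Ω) (V : Ω → ℕ)
    (hV : Measurable V) (h : ∫⁻ ω, (V ω : ENNReal) ∂P ≠ ⊤) :
    Integrable (fun ω => (V ω : ℝ)) P := by
  refine ⟨((measurable_from_nat (f := fun n : ℕ => (n : ℝ))).comp hV).aestronglyMeasurable, ?_⟩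
  rw [hasFiniteIntegral_iff_ofReal (Filter.Eventually.of_forall fun _ => by simp)]
  simpa using lt_top_iff_ne_top.2 h

lemma nat_integrable_mono {Ω : Type*} [MeasurableSpace Ω] (P : Measure Ω) (U V : Ω → ℕ)
    (hU : Measurable U) (hle : ∀ ω, U ω ≤ V ω)
    (h : Integrable (fun ω => (V ω : ℝ)) P) :
    Integrable (fun ω => (U ω : ℝ)) P := by
  refine h.mono' ((measurable_from_nat (f := fun n : ℕ => (n : ℝ))).comp hU).aestronglyMeasurable
    (Filter.Eventually.of_forall fun ω => ?_)
  simpa using hle ω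

/-- Discrete CLT with negative binomial limit: if W = Z + Y with Z ~ Poisson(λ₀)
independent of Y, and W admits a Palm coupling with
∫E[ξ_α]λ̄(dα) ≤ ελ and ∫E[ξ_α(ξ_α−1)]λ̄(dα) ≤ σλ, then with r = λ²/(v−λ),
q = λ/v, we have d_TV(W, NB(r,q)) ≤ (2ε² + σ)/√(2eλ₀). -/
theorem negBinomial_approximation_bound
    {Ω : Type*} [MeasurableSpace Ω] (P : Measure Ω) [IsProbabilityMeasure P]
    {Γ : Type*} [MeasurableSpace Γ] (lamBar : Measure Γ) [IsFiniteMeasure lamBar]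
    (lam0 : ℝ) (hlam0 : 0 < lam0) (Z Y : Ω → ℕ)
    (hZ : Measurable Z) (hY : Measurable Y)
    (hZpois : ∀ k : ℕ, (P (Z ⁻¹' {k})).toReal =
      Real.exp (-lam0) * lam0 ^ k / (Nat.factorial k))
    (hZYindep : IndepFun Z Y P)
    (W : Ω → ℕ) (hWdef : W = fun ω => Z ω + Y ω)
    (lam v : ℝ) (hlam : lam = ∫ ω, (W ω : ℝ) ∂P) (hlampos : 0 < lam)
    (hv : v = variance (fun ω => (W ω : ℝ)) P) (hvlam : lam < v)
    (hW3 : Integrable (fun ω => (W ω : ℝ) ^ 3) P)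
    (hmass : (lamBar Set.univ).toReal = lam)
    (ξ : Γ → Ω → ℕ) (hξmeas : ∀ α, Measurable (ξ α))
    (hξindep : ∀ α, IndepFun (ξ α) W P)
    (hξint1 : Integrable (fun α => ∫ ω, (ξ α ω : ℝ) ∂P) lamBar)
    (hξint2 : Integrable (fun α => ∫ ω, (ξ α ω : ℝ) * ((ξ α ω : ℝ) - 1) ∂P) lamBar)
    (hcoupling : ∀ f : ℕ → ℝ, (∃ C : ℝ, ∀ i, |f i| ≤ C) →
      ∫ ω, (W ω : ℝ) * f (W ω) ∂P = ∫ α, (∫ ω, f (W ω + 1 + ξ α ω) ∂P) ∂lamBar)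
    (ε σ : ℝ) (hε : 0 ≤ ε) (hσ : 0 ≤ σ)
    (hεbound : ∫ α, (∫ ω, (ξ α ω : ℝ) ∂P) ∂lamBar ≤ ε * lam)
    (hσbound : ∫ α, (∫ ω, (ξ α ω : ℝ) * ((ξ α ω : ℝ) - 1) ∂P) ∂lamBar ≤ σ * lam)
    (r q : ℝ) (hr : r = lam ^ 2 / (v - lam)) (hq : q = lam / v) :
    dTVpmf (P.map W) (nbPMF r q) ≤
      (2 * ε ^ 2 + σ) / Real.sqrt (2 * Real.exp 1 * lam0) := by
  set d := 1 / Real.sqrt (2 * Real.exp 1 * lam0) with hd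
  have hd0 : 0 ≤ d := by positivity
  have hW : Measurable W := by rw [hWdef]; exact hZ.add hY
  have hpos : ∀ k, P (W ⁻¹' {k}) ≠ 0 := by
    intro k
    subst hWdef
    exact W_pos P lamBar lam0 hlam0 Z Y hZpois hY hZ hZYindep ξ hcoupling k
  have hWtv : ∀ (u : ℕ → ℝ) (M : ℝ), (∀ i, |u i| ≤ M) →
      |∫ ω, u (W ω + 1) ∂P - ∫ ω, u (W ω) ∂P| ≤ M * (2 * d) := by
    intro u M hu
    rw [hWdef]
    exact W_tv P lam0 hlam0 Z Y hZ hY hZpois hZYindep u M hu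
  have hlin := coupling_lintegral P lamBar W hW hpos ξ hξmeas hcoupling
  have hcint := coupling_integrable P lamBar W hW hpos ξ hξmeas hcoupling
  have hVm : ∀ α, Measurable (fun ω => W ω + 1 + ξ α ω) := fun α =>
    (hW.add_const 1).add (hξmeas α)
  -- moments of W
  have hW3' : Integrable (fun ω => ((W ω ^ 3 : ℕ) : ℝ)) P := by simpa using hW3
  have hW2' : Integrable (fun ω => ((W ω ^ 2 : ℕ) : ℝ)) P := by
    refine nat_integrable_mono P _ (fun ω => W ω ^ 3) (hW.pow_const 2) (fun ω => ?_) hW3'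
    rcases Nat.eq_zero_or_pos (W ω) with h | h
    · simp [h]
    · exact Nat.pow_le_pow_right h (by norm_num)
  have hW1 : Integrable (fun ω => (W ω : ℝ)) P :=
    nat_integrable_mono P W (fun ω => W ω ^ 2) hW (fun ω => Nat.le_self_pow (by norm_num) _) hW2'
  -- good α
  have hgood : ∀ᵐ α ∂lamBar, Integrable (fun ω => ((ξ α ω ^ 2 : ℕ) : ℝ)) P := by
    have h := hlin (fun k => ((k ^ 2 : ℕ) : ENNReal))
    have hfin : ∫⁻ α, (∫⁻ ω, (((W ω + 1 + ξ α ω) ^ 2 : ℕ) : ENNReal) ∂P) ∂lamBar ≠ ⊤ := by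
      rw [h.2]
      have : ∀ ω, (W ω : ENNReal) * ((W ω ^ 2 : ℕ) : ENNReal) = ((W ω ^ 3 : ℕ) : ENNReal) := by
        intro ω; push_cast; ring
      simp only [this]
      rw [nat_lintegral P (fun ω => W ω ^ 3) hW3']
      exact ENNReal.ofReal_ne_top
    filter_upwards [ae_lt_top' h.1 hfin] with α hα
    refine nat_integrable_mono P _ (fun ω => (W ω + 1 + ξ α ω) ^ 2) ((hξmeas α).pow_const 2)
      (fun ω => Nat.pow_le_pow_left (by omega) 2) ?_
    exact nat_integrable_of_lintegral P _ ((hVm α).pow_const 2) hα.ne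
  have hξ1 : ∀ α, Integrable (fun ω => ((ξ α ω ^ 2 : ℕ) : ℝ)) P →
      Integrable (fun ω => (ξ α ω : ℝ)) P := fun α h =>
    nat_integrable_mono P (ξ α) (fun ω => ξ α ω ^ 2) (hξmeas α)
      (fun ω => Nat.le_self_pow (by norm_num) _) h
  -- v - lam
  have hvar : v = ∫ ω, ((W ω ^ 2 : ℕ) : ℝ) ∂P - lam ^ 2 := by
    rw [hv, variance_eq_sub, hlam]
    · simp
    · rw [memLp_two_iff_integrable_sq hW1.aestronglyMeasurable]
      simpa using hW2'
  have hE1 : ∫ α, (∫ ω, (ξ α ω : ℝ) ∂P) ∂lamBar = v - lam := by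
    have h := (hlin (fun k => (k : ENNReal))).2
    have h1 : ∀ ω, (W ω : ENNReal) * (W ω : ENNReal) = ((W ω ^ 2 : ℕ) : ENNReal) := by
      intro ω; push_cast; ring
    simp only [h1] at h
    rw [nat_lintegral P (fun ω => W ω ^ 2) hW2'] at h
    have h2 : ∫⁻ α, (∫⁻ ω, ((W ω + 1 + ξ α ω : ℕ) : ENNReal) ∂P) ∂lamBar =
        ∫⁻ α, ENNReal.ofReal (lam + 1 + ∫ ω, (ξ α ω : ℝ) ∂P) ∂lamBar := by
      refine lintegral_congr_ae ?_
      filter_upwards [hgood] with α hα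
      have hi := hξ1 α hα
      have hi2 : Integrable (fun ω => ((W ω : ℝ) + 1)) P := hW1.add (integrable_const 1)
      rw [nat_lintegral P (fun ω => W ω + 1 + ξ α ω)]
      · push_cast
        rw [integral_add hi2 hi, integral_add hW1 (integrable_const 1), hlam]
        simp
      · push_cast
        exact hi2.add hi
    have h0 : ∀ α, 0 ≤ ∫ ω, (ξ α ω : ℝ) ∂P := fun α => integral_nonneg fun ω => by simp
    have hint3 : Integrable (fun α => lam + 1 + ∫ ω, (ξ α ω : ℝ) ∂P) lamBar :=
      (integrable_const _).add hξint1
    rw [h2, ← ofReal_integral_eq_lintegral_ofReal hint3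
      (Filter.Eventually.of_forall fun α => by
        have := h0 α
        simp only [Pi.zero_apply]
        linarith)] at h
    rw [ENNReal.ofReal_eq_ofReal_iff (integral_nonneg fun α => by
        have := h0 α
        simp only [Pi.zero_apply]
        linarith) (integral_nonneg fun ω => by positivity),
      integral_add (integrable_const _) hξint1] at h
    simp only [integral_const, measureReal_def, hmass, smul_eq_mul] at h
    rw [hvar]
    linarith
  -- parameters
  have hv0 : 0 < v := hlampos.trans hvlam
  have hvl : 0 < v - lam := by linarith
  have hq0 : 0 < q := by rw [hq]; positivity
  have hq1 : q < 1 := by rw [hq, div_lt_one hv0]; exact hvlam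
  have hr0 : 0 < r := by rw [hr]; positivity
  obtain ⟨p, hp⟩ : ∃ p, p = 1 - q := ⟨_, rfl⟩
  have hp0 : 0 < p := by linarith
  have hp1 : p < 1 := by linarith
  have hpv : p = (v - lam) / v := by rw [hp, hq]; field_simp
  have hpr : p * r = lam * q := by rw [hpv, hr, hq]; field_simp
  have hpq0 : p * lam - q * (v - lam) = 0 := by rw [hpv, hq]; field_simp; ring
  unfold dTVpmf
  refine ciSup_le fun A => ?_
  obtain ⟨g, ⟨C, hC⟩, hΔ, hst⟩ := nb_stein (nbPMF r q) p r hp0 hp1 hr0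
    (nb_pos r q hr0 hq0 hq1) (nb_hasSum r q hr0 hq0 hq1)
    (fun i => by rw [hp]; exact nb_rec r q hr0 i) A
  set PA := ∑' j, A.indicator (nbPMF r q) j with hPA
  have hWg : ∀ f : ℕ → ℝ, (∀ i, |f i| ≤ C) → Integrable (fun ω => (W ω : ℝ) * f (W ω)) P := by
    intro f hf
    refine (hW1.mul_const C).mono' ((measurable_from_nat
      (f := fun n : ℕ => (n : ℝ) * f n)).comp hW).aestronglyMeasurable
      (Filter.Eventually.of_forall fun ω => ?_)
    rw [norm_mul, Real.norm_natCast]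
    exact mul_le_mul_of_nonneg_left (hf _) (by simp)
  let G : ℕ → ℝ := fun j => ∫ ω, g (W ω + 1 + j) ∂P
  have hGC : ∀ j, |G j| ≤ C := fun j => abs_integral_bdd P _ C fun _ => hC _
  have hGi : ∀ j, Integrable (fun ω => g (W ω + 1 + j)) P := fun j =>
    integrable_bdd P W hW (fun n => g (n + 1 + j)) C fun _ => hC _
  have hD : ((P.map W) A).toReal - PA =
      ∫ α, (q * G 0 + p * (∫ ω, g (W ω + 1 + ξ α ω + 1) ∂P)
        - ∫ ω, g (W ω + 1 + ξ α ω) ∂P) ∂lamBar := by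
    have c1 := hcoupling (fun n => g (n + 1)) ⟨C, fun _ => hC _⟩
    have c0 := hcoupling g ⟨C, hC⟩
    have i1 := hcint (fun n => g (n + 1)) C (fun _ => hC _)
    have i0 := hcint g C hC
    have iA : Integrable (fun ω => q * G 0 + p * (∫ ω', g (W ω' + 1 + ξ ω ω' + 1) ∂P)) lamBar :=
      (integrable_const _).add (i1.const_mul p)
    rw [integral_sub iA i0, integral_add (integrable_const _) (i1.const_mul p),
      integral_const_mul, integral_const_mul]
    rw [← c1, ← c0]
    simp only [integral_const, measureReal_def, hmass, smul_eq_mul]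
    have e1 : ((P.map W) A).toReal = ∫ ω, (A.indicator 1 (W ω) : ℝ) ∂P := by
      rw [Measure.map_apply hW (MeasurableSet.of_discrete), ← measureReal_def,
        ← integral_indicator_one (hW MeasurableSet.of_discrete)]
      rfl
    have iI : Integrable (fun ω => (A.indicator 1 (W ω) : ℝ)) P := by
      refine integrable_bdd P W hW (A.indicator 1) 1 fun i => ?_
      by_cases h : i ∈ A <;> simp [h]
    have e2 : ((P.map W) A).toReal - PA = ∫ ω, ((A.indicator 1 (W ω) : ℝ) - PA) ∂P := by
      rw [integral_sub iI (integrable_const _), e1]; simp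
    rw [e2]
    have e3 : ∀ ω, (A.indicator 1 (W ω) : ℝ) - PA = p * r * g (W ω + 1 + 0)
        + p * ((W ω : ℝ) * g (W ω + 1)) - (W ω : ℝ) * g (W ω) := by
      intro ω
      rw [← hst (W ω), add_zero]; ring
    simp only [e3]
    have j1 := (hGi 0).const_mul (p * r)
    have j2 := (hWg (fun n => g (n + 1)) (fun _ => hC _)).const_mul p
    have j3 : Integrable (fun ω => p * r * g (W ω + 1 + 0) + p * ((W ω : ℝ) * g (W ω + 1))) P :=
      j1.add j2
    rw [integral_sub j3 (hWg g hC), integral_add j1 j2, integral_const_mul,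
      integral_const_mul, hpr]
    simp only [G]
    ring
  have hzero : ∫ α, (G 1 - G 0) * (p - q * ∫ ω, (ξ α ω : ℝ) ∂P) ∂lamBar = 0 := by
    rw [integral_const_mul, integral_sub (integrable_const _) (hξint1.const_mul q),
      integral_const_mul, hE1]
    simp only [integral_const, measureReal_def, hmass, smul_eq_mul]
    have : lam * p - q * (v - lam) = 0 := by linarith
    rw [this, mul_zero]
  set B := 1 / (p * r) * (2 * d) with hBdef
  have hB0 : 0 ≤ B := by positivity
  have hB : ∀ j, |(G (j + 2) - G (j + 1)) - (G (j + 1) - G j)| ≤ B := by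
    intro j
    have h := hWtv (fun n => g (n + j + 2) - g (n + j + 1)) (1 / (p * r)) (fun i => hΔ (i + j))
    have e1 : ∫ ω, (g (W ω + 1 + j + 2) - g (W ω + 1 + j + 1)) ∂P = G (j + 2) - G (j + 1) :=
      integral_sub (hGi (j + 2)) (hGi (j + 1))
    have e2 : ∫ ω, (g (W ω + j + 2) - g (W ω + j + 1)) ∂P = G (j + 1) - G j := by
      have : ∀ ω, g (W ω + j + 2) - g (W ω + j + 1) = g (W ω + 1 + (j + 1)) - g (W ω + 1 + j) := by
        intro ω
        congr 2 <;> omega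
      simp only [this]
      exact integral_sub (hGi (j + 1)) (hGi j)
    rw [e1, e2] at h
    exact h
  have hbound : |((P.map W) A).toReal - PA| ≤
      ∫ α, B * (q * (∫ ω, (ξ α ω : ℝ) * ((ξ α ω : ℝ) - 1) ∂P) / 2
        + p * ∫ ω, (ξ α ω : ℝ) ∂P) ∂lamBar := by
    have i1 := hcint (fun n => g (n + 1)) C (fun _ => hC _)
    have i0 := hcint g C hC
    have iA : Integrable (fun α => q * G 0 + p * (∫ ω, g (W ω + 1 + ξ α ω + 1) ∂P)
        - ∫ ω, g (W ω + 1 + ξ α ω) ∂P) lamBar :=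
      ((integrable_const _).add (i1.const_mul p)).sub i0
    have iH : Integrable (fun α => (G 1 - G 0) * (p - q * ∫ ω, (ξ α ω : ℝ) ∂P)) lamBar :=
      ((integrable_const _).sub (hξint1.const_mul q)).const_mul _
    have iB : Integrable (fun α => B * (q * (∫ ω, (ξ α ω : ℝ) * ((ξ α ω : ℝ) - 1) ∂P) / 2
        + p * ∫ ω, (ξ α ω : ℝ) ∂P)) lamBar :=
      (((hξint2.const_mul q).div_const 2).add (hξint1.const_mul p)).const_mul B
    have e : ((P.map W) A).toReal - PA =
      ∫ α, ((q * G 0 + p * (∫ ω, g (W ω + 1 + ξ α ω + 1) ∂P)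
        - ∫ ω, g (W ω + 1 + ξ α ω) ∂P) - (G 1 - G 0) * (p - q * ∫ ω, (ξ α ω : ℝ) ∂P)) ∂lamBar := by
      rw [integral_sub iA iH, hzero, hD, sub_zero]
    rw [e, ← Real.norm_eq_abs]
    refine norm_integral_le_of_norm_le iB ?_
    filter_upwards [hgood] with α hα
    have hξi := hξ1 α hα
    have hξi2 : Integrable (fun ω => (ξ α ω : ℝ) * ((ξ α ω : ℝ) - 1)) P := by
      have := hα.sub hξi
      refine this.congr (Filter.Eventually.of_forall fun ω => ?_)
      simp only [Pi.sub_apply]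
      push_cast; ring
    have f0 : ∫ ω, g (W ω + 1 + ξ α ω) ∂P = ∫ ω, G (ξ α ω) ∂P :=
      indep_integral P (ξ α) W (hξmeas α) hW (hξindep α) (fun x w => g (w + 1 + x)) C
        (fun _ _ => hC _)
    have f1 : ∫ ω, g (W ω + 1 + ξ α ω + 1) ∂P = ∫ ω, G (ξ α ω + 1) ∂P :=
      indep_integral P (ξ α) W (hξmeas α) hW (hξindep α) (fun x w => g (w + 1 + x + 1)) C
        (fun _ _ => hC _)
    have k0 : Integrable (fun ω => G (ξ α ω)) P := integrable_bdd P (ξ α) (hξmeas α) G C hGC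
    have k1 : Integrable (fun ω => G (ξ α ω + 1)) P :=
      integrable_bdd P (ξ α) (hξmeas α) (fun n => G (n + 1)) C (fun _ => hGC _)
    have kc : Integrable (fun _ : Ω => q * G 0) P := integrable_const _
    have kp : Integrable (fun _ : Ω => p) P := integrable_const _
    have kA : Integrable (fun ω => q * G 0 + p * G (ξ α ω + 1)) P := kc.add (k1.const_mul p)
    have kB : Integrable (fun ω => q * G 0 + p * G (ξ α ω + 1) - G (ξ α ω)) P := kA.sub k0
    have kH : Integrable (fun ω => p - q * (ξ α ω : ℝ)) P := kp.sub (hξi.const_mul q)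
    have f2 : q * G 0 + p * (∫ ω, g (W ω + 1 + ξ α ω + 1) ∂P) - ∫ ω, g (W ω + 1 + ξ α ω) ∂P
        - (G 1 - G 0) * (p - q * ∫ ω, (ξ α ω : ℝ) ∂P) =
        ∫ ω, (q * G 0 + p * G (ξ α ω + 1) - G (ξ α ω) - (G 1 - G 0) * (p - q * ξ α ω)) ∂P := by
      rw [integral_sub kB (kH.const_mul _), integral_sub kA k0, integral_add kc (k1.const_mul p),
        integral_const_mul, integral_const_mul, integral_const_mul, integral_sub kp (hξi.const_mul q),
        integral_const_mul, f0, f1]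
      simp
    have kS : Integrable (fun ω => q * ((ξ α ω : ℝ) * ((ξ α ω : ℝ) - 1)) / 2) P :=
      (hξi2.const_mul q).div_const 2
    have f3 : B * (q * (∫ ω, (ξ α ω : ℝ) * ((ξ α ω : ℝ) - 1) ∂P) / 2
        + p * ∫ ω, (ξ α ω : ℝ) ∂P) =
        ∫ ω, B * (q * ((ξ α ω : ℝ) * ((ξ α ω : ℝ) - 1)) / 2 + p * (ξ α ω : ℝ)) ∂P := by
      rw [integral_const_mul, integral_add kS (hξi.const_mul p), integral_div,
        integral_const_mul, integral_const_mul]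
    rw [f2, f3]
    refine norm_integral_le_of_norm_le ((kS.add (hξi.const_mul p)).const_mul B) ?_
    exact Filter.Eventually.of_forall fun ω =>
      det_bound G B p q hp0.le hq0.le (by linarith) hB (ξ α ω)
  refine hbound.trans ?_
  rw [integral_const_mul, integral_add ((hξint2.const_mul q).div_const 2) (hξint1.const_mul p),
    integral_div, integral_const_mul, integral_const_mul, hE1]
  rw [hE1] at hεbound
  generalize ∫ α, (∫ ω, (ξ α ω : ℝ) * ((ξ α ω : ℝ) - 1) ∂P) ∂lamBar = S at hσbound
  have e1 : B * (q * S / 2 + p * (v - lam)) = d * ((lam * S + 2 * (v - lam) ^ 2) / lam ^ 2) := by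
    rw [hBdef, hpr, hpv, hq]
    field_simp
  have e2 : (lam * S + 2 * (v - lam) ^ 2) / lam ^ 2 ≤ 2 * ε ^ 2 + σ := by
    rw [div_le_iff₀ (by positivity)]
    have h1 := mul_le_mul_of_nonneg_left hσbound hlampos.le
    have h2 := pow_le_pow_left₀ hvl.le hεbound 2
    nlinarith
  rw [e1]
  calc _ ≤ d * (2 * ε ^ 2 + σ) := mul_le_mul_of_nonneg_left e2 hd0
    _ = _ := by rw [hd]; ring
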